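/- arXiv:2512.00669 — 2 statements merged into one kernel-verified Lean document; each statement's English description precedes it below -/
import Mathlib

section
/- Let p ≥ 1 and let B ∈ ℝ^{(p+1)×p} admit a singular value decomposition B = Û Σ̂ V̂ᵀ, where Û ∈ ℝ^{(p+1)×(p+1)} and V̂ ∈ ℝ^{p×p} are orthogonal and Σ̂ ∈ ℝ^{(p+1)×p} has (i,j) entry σ̂_i when i = j and 0 otherwise, with σ̂_i > 0 for each i = 1, …, p. Fix α > 0 and b̃ ∈ ℝ^{p+1}, and define iterates by y^{(0)} = 0 and y^{(k)} = y^{(k-1)} + (BᵀB + α²I)⁻¹ Bᵀ (b̃ − B y^{(k-1)}) for k ≥ 1. Then for every k ≥ 0, y^{(k)} = Σ_{i=1}^{p} ψ_i^{(k)} (û_iᵀ b̃ / σ̂_i) v̂_i with filter factors ψ_i^{(k)} = 1 − (α²/(σ̂_i² + α²))^k, where û_i and v̂_i denote the i-th columns of Û and V̂, respectively. -/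
open Matrix Finset

/-- **Proposition 1 (Filtered Solution of Stationary PIT).**
Let `B ∈ ℝ^{(p+1)×p}` have the SVD `B = Û Σ̂ V̂ᵀ` with orthogonal `Û, V̂` and
`Σ̂` diagonal with positive singular values `σ̂ i`.  For a fixed regularization
parameter `α > 0` the projected iterated Tikhonov iterates
`y⁽ᵏ⁾ = y⁽ᵏ⁻¹⁾ + (BᵀB + α²I)⁻¹ Bᵀ (b̃ − B y⁽ᵏ⁻¹⁾)`, `y⁽⁰⁾ = 0`, satisfy
`y⁽ᵏ⁾ = Σᵢ (1 − (α²/(σ̂ᵢ² + α²))ᵏ) (ûᵢᵀ b̃ / σ̂ᵢ) v̂ᵢ`. -/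
theorem stationary_PIT_filtered_solution
    (p : ℕ) (hp : 1 ≤ p)
    (B : Matrix (Fin (p + 1)) (Fin p) ℝ)
    (Uhat : Matrix (Fin (p + 1)) (Fin (p + 1)) ℝ)
    (Vhat : Matrix (Fin p) (Fin p) ℝ)
    (hU : Uhatᵀ * Uhat = 1 ∧ Uhat * Uhatᵀ = 1)
    (hV : Vhatᵀ * Vhat = 1 ∧ Vhat * Vhatᵀ = 1)
    (σ : Fin p → ℝ) (hσ : ∀ i, 0 < σ i)
    (Shat : Matrix (Fin (p + 1)) (Fin p) ℝ)
    (hS : ∀ i j, Shat i j = if (i : ℕ) = (j : ℕ) then σ j else 0)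
    (hSVD : B = Uhat * Shat * Vhatᵀ)
    (α : ℝ) (hα : 0 < α)
    (btil : Fin (p + 1) → ℝ)
    (y : ℕ → Fin p → ℝ)
    (hy0 : y 0 = 0)
    (hyk : ∀ k : ℕ,
      y (k + 1) = y k +
        (Bᵀ * B + α ^ 2 • (1 : Matrix (Fin p) (Fin p) ℝ))⁻¹ *ᵥ
          (Bᵀ *ᵥ (btil - B *ᵥ y k))) :
    ∀ k : ℕ,
      y k = ∑ i : Fin p,
        (1 - (α ^ 2 / (σ i ^ 2 + α ^ 2)) ^ k) •
          (((fun j => Uhat j (Fin.castSucc i)) ⬝ᵥ btil / σ i) •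
            (fun j => Vhat j i)) := by
  obtain ⟨hU1, -⟩ := hU
  obtain ⟨hV1, hV2⟩ := hV
  have hpos : ∀ i, σ i ^ 2 + α ^ 2 ≠ 0 := fun i => by positivity
  have hSv : ∀ (w : Fin (p + 1) → ℝ) (i : Fin p),
      (Shatᵀ *ᵥ w) i = σ i * w (Fin.castSucc i) := by
    intro w i
    have hne : (i : ℕ) ≠ p := i.isLt.ne
    simp only [Matrix.mulVec, dotProduct, Matrix.transpose_apply, hS]
    rw [Finset.sum_eq_single (Fin.castSucc i)]
    · simp
    · intro b _ hb
      rw [if_neg, zero_mul]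
      intro h
      exact hb (Fin.ext h)
    · simp
  have hSS : Shatᵀ * Shat = Matrix.diagonal (fun i => σ i ^ 2) := by
    ext i j
    have h := hSv (fun k => Shat k j) i
    change (Shatᵀ * Shat) i j = _ at h
    rw [h, hS, Matrix.diagonal_apply]
    by_cases hij : i = j
    · subst hij; simp; ring
    · have : (i : ℕ) ≠ j := fun h => hij (Fin.ext h)
      simp [hij, this]
  have hBT : Bᵀ = Vhat * Shatᵀ * Uhatᵀ := by
    rw [hSVD]; simp [Matrix.transpose_mul, Matrix.mul_assoc]
  have hBTB : Bᵀ * B = Vhat * Matrix.diagonal (fun i => σ i ^ 2) * Vhatᵀ := by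
    rw [hBT, hSVD, ← hSS]
    calc _ = Vhat * Shatᵀ * (Uhatᵀ * Uhat) * Shat * Vhatᵀ := by
          simp only [Matrix.mul_assoc]
      _ = _ := by rw [hU1]; simp only [Matrix.mul_one, Matrix.mul_assoc]
  have hM : Bᵀ * B + α ^ 2 • (1 : Matrix (Fin p) (Fin p) ℝ)
      = Vhat * Matrix.diagonal (fun i => σ i ^ 2 + α ^ 2) * Vhatᵀ := by
    have h1 : Matrix.diagonal (fun i => σ i ^ 2 + α ^ 2)
        = Matrix.diagonal (fun i => σ i ^ 2) + α ^ 2 • (1 : Matrix (Fin p) (Fin p) ℝ) := by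
      ext i j
      by_cases hij : i = j
      · subst hij; simp
      · simp [hij]
    rw [h1, hBTB, Matrix.mul_add, Matrix.add_mul]
    simp [hV2]
  have hinv : (Bᵀ * B + α ^ 2 • (1 : Matrix (Fin p) (Fin p) ℝ))⁻¹
      = Vhat * Matrix.diagonal (fun i => (σ i ^ 2 + α ^ 2)⁻¹) * Vhatᵀ := by
    apply Matrix.inv_eq_right_inv
    rw [hM]
    have hD : Matrix.diagonal (fun i => σ i ^ 2 + α ^ 2)
        * Matrix.diagonal (fun i => (σ i ^ 2 + α ^ 2)⁻¹)
        = (1 : Matrix (Fin p) (Fin p) ℝ) := by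
      rw [Matrix.diagonal_mul_diagonal, ← Matrix.diagonal_one]
      congr 1
      funext i
      exact mul_inv_cancel₀ (hpos i)
    calc _ = Vhat * Matrix.diagonal (fun i => σ i ^ 2 + α ^ 2) * (Vhatᵀ * Vhat)
          * Matrix.diagonal (fun i => (σ i ^ 2 + α ^ 2)⁻¹) * Vhatᵀ := by
          simp only [Matrix.mul_assoc]
      _ = Vhat * (Matrix.diagonal (fun i => σ i ^ 2 + α ^ 2)
          * Matrix.diagonal (fun i => (σ i ^ 2 + α ^ 2)⁻¹)) * Vhatᵀ := by
          rw [hV1]; simp only [Matrix.mul_one, Matrix.mul_assoc]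
      _ = 1 := by rw [hD, Matrix.mul_one, hV2]
  have hstep : ∀ z : Fin p → ℝ,
      Vhat *ᵥ z + (Bᵀ * B + α ^ 2 • (1 : Matrix (Fin p) (Fin p) ℝ))⁻¹ *ᵥ
          (Bᵀ *ᵥ (btil - B *ᵥ (Vhat *ᵥ z)))
      = Vhat *ᵥ (z + Matrix.diagonal (fun i => (σ i ^ 2 + α ^ 2)⁻¹) *ᵥ
          (Shatᵀ *ᵥ (Uhatᵀ *ᵥ btil) - Matrix.diagonal (fun i => σ i ^ 2) *ᵥ z)) := by
    intro z
    have h2 : Bᵀ *ᵥ (btil - B *ᵥ (Vhat *ᵥ z)) = Vhat *ᵥ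
        (Shatᵀ *ᵥ (Uhatᵀ *ᵥ btil) - Matrix.diagonal (fun i => σ i ^ 2) *ᵥ z) := by
      rw [Matrix.mulVec_sub, Matrix.mulVec_mulVec _ Bᵀ B, hBTB, hBT, Matrix.mulVec_sub]
      simp only [Matrix.mulVec_mulVec, Matrix.mul_assoc, hV1, Matrix.mul_one]
    rw [h2, hinv, Matrix.mulVec_add]
    congr 1
    simp only [Matrix.mulVec_mulVec, Matrix.mul_assoc, hV1, Matrix.mul_one]
  have hform : ∀ z c : Fin p → ℝ,
      ∑ i : Fin p, z i • (c i • (fun j => Vhat j i)) = Vhat *ᵥ (fun i => z i * c i) := by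
    intro z c
    funext j
    simp only [Finset.sum_apply, Pi.smul_apply, smul_eq_mul, Matrix.mulVec, dotProduct]
    exact Finset.sum_congr rfl fun i _ => by ring
  intro k
  rw [hform]
  induction k with
  | zero =>
    rw [hy0]
    funext j
    simp [Matrix.mulVec, dotProduct]
  | succ k ih =>
    rw [hyk, ih, hstep]
    congr 1
    funext i
    have hu : (Uhatᵀ *ᵥ btil) (Fin.castSucc i)
        = (fun j => Uhat j (Fin.castSucc i)) ⬝ᵥ btil := rfl
    simp only [Pi.add_apply, Matrix.mulVec_diagonal, Pi.sub_apply, hSv, hu]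
    have h1 := hpos i
    have h2 := (hσ i).ne'
    generalize (fun j => Uhat j (Fin.castSucc i)) ⬝ᵥ btil = c
    rw [pow_succ _ k]
    generalize (α ^ 2 / (σ i ^ 2 + α ^ 2)) ^ k = t
    field_simp
    ring
end

section
/- Let p ≥ 1 and let B ∈ ℝ^{(p+1)×p} admit a singular value decomposition B = Û Σ̂ V̂ᵀ, where Û ∈ ℝ^{(p+1)×(p+1)} and V̂ ∈ ℝ^{p×p} are orthogonal and Σ̂ ∈ ℝ^{(p+1)×p} has (i,j) entry σ̂_i when i = j and 0 otherwise, with σ̂_i > 0 for each i = 1, …, p. Let (α^{(k)})_{k≥1} be a sequence of positive real numbers, fix b̃ ∈ ℝ^{p+1}, and define iterates by y^{(0)} = 0 and y^{(k)} = y^{(k-1)} + (BᵀB + [α^{(k)}]²I)⁻¹ Bᵀ (b̃ − B y^{(k-1)}) for k ≥ 1. Define filter factors recursively by ψ_i^{(0)} = 0 and ψ_i^{(k)} = σ̂_i²/(σ̂_i² + [α^{(k)}]²) + (1 − σ̂_i²/(σ̂_i² + [α^{(k)}]²)) ψ_i^{(k-1)} for i = 1, …, p. Then for every k ≥ 0,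 y^{(k)} = Σ_{i=1}^{p} ψ_i^{(k)} (û_iᵀ b̃ / σ̂_i) v̂_i, where û_i and v̂_i denote the i-th columns of Û and V̂, respectively. -/
open Matrix Finset

/-- **Proposition 2 (Nonstationary Filtered Solution of PIT).**
With the SVD `B = Û Σ̂ V̂ᵀ` as before and a sequence of positive regularization
parameters `α⁽ᵏ⁾`, the nonstationary projected iterated Tikhonov iterates
`y⁽ᵏ⁾ = y⁽ᵏ⁻¹⁾ + (BᵀB + [α⁽ᵏ⁾]²I)⁻¹ Bᵀ (b̃ − B y⁽ᵏ⁻¹⁾)`, `y⁽⁰⁾ = 0`, satisfy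
`y⁽ᵏ⁾ = Σᵢ ψᵢ⁽ᵏ⁾ (ûᵢᵀ b̃ / σ̂ᵢ) v̂ᵢ` with the recursively defined filter factors
`ψᵢ⁽⁰⁾ = 0`,
`ψᵢ⁽ᵏ⁾ = σ̂ᵢ²/(σ̂ᵢ² + [α⁽ᵏ⁾]²) + (1 − σ̂ᵢ²/(σ̂ᵢ² + [α⁽ᵏ⁾]²)) ψᵢ⁽ᵏ⁻¹⁾`. -/
theorem nonstationary_PIT_filtered_solution
    (p : ℕ) (hp : 1 ≤ p)
    (B : Matrix (Fin (p + 1)) (Fin p) ℝ)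
    (Uhat : Matrix (Fin (p + 1)) (Fin (p + 1)) ℝ)
    (Vhat : Matrix (Fin p) (Fin p) ℝ)
    (hU : Uhatᵀ * Uhat = 1 ∧ Uhat * Uhatᵀ = 1)
    (hV : Vhatᵀ * Vhat = 1 ∧ Vhat * Vhatᵀ = 1)
    (σ : Fin p → ℝ) (hσ : ∀ i, 0 < σ i)
    (Shat : Matrix (Fin (p + 1)) (Fin p) ℝ)
    (hS : ∀ i j, Shat i j = if (i : ℕ) = (j : ℕ) then σ j else 0)
    (hSVD : B = Uhat * Shat * Vhatᵀ)
    (α : ℕ → ℝ) (hα : ∀ k : ℕ, 1 ≤ k → 0 < α k)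
    (btil : Fin (p + 1) → ℝ)
    (y : ℕ → Fin p → ℝ)
    (hy0 : y 0 = 0)
    (hyk : ∀ k : ℕ,
      y (k + 1) = y k +
        (Bᵀ * B + (α (k + 1)) ^ 2 • (1 : Matrix (Fin p) (Fin p) ℝ))⁻¹ *ᵥ
          (Bᵀ *ᵥ (btil - B *ᵥ y k)))
    (ψ : ℕ → Fin p → ℝ)
    (hψ0 : ∀ i, ψ 0 i = 0)
    (hψk : ∀ (k : ℕ) (i : Fin p),
      ψ (k + 1) i = σ i ^ 2 / (σ i ^ 2 + (α (k + 1)) ^ 2) +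
        (1 - σ i ^ 2 / (σ i ^ 2 + (α (k + 1)) ^ 2)) * ψ k i) :
    ∀ k : ℕ,
      y k = ∑ i : Fin p,
        ψ k i •
          (((fun j => Uhat j (Fin.castSucc i)) ⬝ᵥ btil / σ i) •
            (fun j => Vhat j i)) := by
  have hSt : ∀ w : Fin (p + 1) → ℝ, Shatᵀ *ᵥ w = fun i => σ i * w (Fin.castSucc i) := by
    intro w
    ext i
    simp only [mulVec, dotProduct, transpose_apply, hS]
    rw [Finset.sum_eq_single (Fin.castSucc i)]
    · simp
    · intro b _ hb
      have : (b : ℕ) ≠ (i : ℕ) := fun h => hb (Fin.ext (by simpa using h))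
      simp [this]
    · simp
  have hSS : Shatᵀ * Shat = diagonal (fun i => σ i ^ 2) := by
    ext i j
    have h := congrFun (hSt (fun l => Shat l j)) i
    have h2 : (Shatᵀ * Shat) i j = (Shatᵀ *ᵥ (fun l => Shat l j)) i := rfl
    rw [h2, h]
    simp only [hS, diagonal_apply, Fin.val_castSucc, ← Fin.ext_iff]
    by_cases hij : i = j
    · subst hij; simp [sq]
    · simp [hij]
  have hBB : Bᵀ * B = Vhat * diagonal (fun i => σ i ^ 2) * Vhatᵀ := by
    rw [hSVD, ← hSS]
    simp only [transpose_mul, transpose_transpose, Matrix.mul_assoc]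
    rw [← Matrix.mul_assoc Uhatᵀ Uhat, hU.1, Matrix.one_mul]
  have hsum : ∀ c : Fin p → ℝ, ∀ k, (∑ i : Fin p, ψ k i • ((c i / σ i) •
      (fun j => Vhat j i))) = Vhat *ᵥ (fun i => ψ k i * (c i / σ i)) := by
    intro c k
    ext j
    simp only [Finset.sum_apply, Pi.smul_apply, smul_eq_mul, mulVec, dotProduct]
    exact Finset.sum_congr rfl fun i _ => by ring
  intro k
  rw [hsum (fun i => (fun j => Uhat j (Fin.castSucc i)) ⬝ᵥ btil)]
  induction k with
  | zero => rw [hy0]; ext j; simp [hψ0, mulVec, dotProduct]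
  | succ k ih =>
    have hpos : ∀ i, σ i ^ 2 + α (k + 1) ^ 2 ≠ 0 := fun i => by
      have := hσ i
      positivity
    have hinv : (Bᵀ * B + (α (k + 1)) ^ 2 • (1 : Matrix (Fin p) (Fin p) ℝ))⁻¹
        = Vhat * diagonal (fun i => (σ i ^ 2 + α (k + 1) ^ 2)⁻¹) * Vhatᵀ := by
      apply Matrix.inv_eq_right_inv
      have h1 : Bᵀ * B + (α (k + 1)) ^ 2 • (1 : Matrix (Fin p) (Fin p) ℝ)
          = Vhat * diagonal (fun i => σ i ^ 2 + α (k + 1) ^ 2) * Vhatᵀ := by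
        have h3 : diagonal (fun i => σ i ^ 2 + α (k + 1) ^ 2)
            = diagonal (fun i => σ i ^ 2) + (α (k + 1)) ^ 2 • (1 : Matrix (Fin p) (Fin p) ℝ) := by
          rw [smul_one_eq_diagonal, diagonal_add]
        rw [hBB, h3, Matrix.mul_add, Matrix.add_mul, Matrix.mul_smul, Matrix.smul_mul,
          Matrix.mul_one, hV.2]
      rw [h1]
      have h4 : ∀ D E : Matrix (Fin p) (Fin p) ℝ,
          Vhat * D * Vhatᵀ * (Vhat * E * Vhatᵀ) = Vhat * (D * E) * Vhatᵀ := by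
        intro D E
        simp only [Matrix.mul_assoc]
        rw [← Matrix.mul_assoc Vhatᵀ Vhat, hV.1, Matrix.one_mul]
      rw [h4, diagonal_mul_diagonal]
      have h5 : (fun i => (σ i ^ 2 + α (k + 1) ^ 2) * (σ i ^ 2 + α (k + 1) ^ 2)⁻¹)
          = fun _ : Fin p => (1 : ℝ) := funext fun i => mul_inv_cancel₀ (hpos i)
      rw [h5, diagonal_one, Matrix.mul_one, hV.2]
    have hBt : Bᵀ *ᵥ btil = Vhat *ᵥ (fun i => σ i * ((fun j => Uhat j (Fin.castSucc i)) ⬝ᵥ btil)) := by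
      have h6 : Bᵀ = Vhat * (Shatᵀ * Uhatᵀ) := by
        rw [hSVD]; simp [transpose_mul]
      rw [h6, ← mulVec_mulVec, ← mulVec_mulVec, hSt]
      rfl
    have hVV : ∀ x : Fin p → ℝ, Vhatᵀ *ᵥ (Vhat *ᵥ x) = x := fun x => by
      rw [mulVec_mulVec, hV.1, one_mulVec]
    rw [hyk, hinv, mulVec_sub, mulVec_mulVec, hBB, hBt, ih]
    simp only [← mulVec_mulVec, hVV, ← mulVec_sub]
    rw [← mulVec_add]
    congr 1
    ext i
    simp only [Pi.add_apply, Pi.sub_apply, mulVec_diagonal, hψk]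
    have h7 := hpos i
    have h8 := (hσ i).ne'
    field_simp
    ring
end
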